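/- arXiv:1906.05023 — 3 statements merged into one kernel-verified Lean document; each statement's English description precedes it below -/
import Mathlib

section
/- Let τ, L, w, κ, V, f_max be positive real numbers and Q ≥ 0. Define f* = min{f_max, √(τ·Q/(3·L·w·κ·V))}. Then for every f with 0 ≤ f ≤ f_max, one has −(τ·Q/L)·f* + V·w·κ·(f*)³ ≤ −(τ·Q/L)·f + V·w·κ·f³; that is, f* minimizes the function f ↦ −(τ·Q/L)·f + V·w·κ·f³ over [0, f_max]. -/
/-- On `[0, b]` with `0 ≤ s`, the cubic `x ↦ x ^ 3 - 3 * s ^ 2 * x` is minimized at `min b s`. -/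
theorem cubic_min_le {b s x : ℝ} (hs : 0 ≤ s) (hx : 0 ≤ x) (hxb : x ≤ b) :
    (min b s) ^ 3 - 3 * s ^ 2 * min b s ≤ x ^ 3 - 3 * s ^ 2 * x := by
  rcases le_total b s with h | h
  · rw [min_eq_left h]
    have hb : 0 ≤ b := hx.trans hxb
    have h1 : b ^ 2 ≤ s ^ 2 := by gcongr
    have h2 : x ^ 2 ≤ b ^ 2 := by gcongr
    have h3 : b * x ≤ b ^ 2 := by nlinarith
    have h4 : 0 ≤ (b - x) * (3 * s ^ 2 - b ^ 2 - b * x - x ^ 2) :=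
      mul_nonneg (by linarith) (by linarith)
    linarith
  · rw [min_eq_right h]
    have h1 : 0 ≤ (x - s) ^ 2 * (x + 2 * s) := by positivity
    linarith

/-- Closed-form optimal edge processor frequency (paper's equation (28)):
`f* = min (f_max) (√(τ Q / (3 L w κ V)))` minimizes
`f ↦ -(τ Q / L) f + V w κ f³` over `[0, f_max]`. -/
theorem optimal_processor_frequency (τ L w κ V fmax Q : ℝ)
    (hτ : 0 < τ) (hL : 0 < L) (hw : 0 < w) (hκ : 0 < κ) (hV : 0 < V)
    (hfmax : 0 < fmax) (hQ : 0 ≤ Q) :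
    ∀ f : ℝ, 0 ≤ f → f ≤ fmax →
      -(τ * Q / L) * min fmax (Real.sqrt (τ * Q / (3 * L * w * κ * V))) +
          V * w * κ * (min fmax (Real.sqrt (τ * Q / (3 * L * w * κ * V)))) ^ 3 ≤
        -(τ * Q / L) * f + V * w * κ * f ^ 3 := by
  intro f hf hfm
  have hsq : Real.sqrt (τ * Q / (3 * L * w * κ * V)) ^ 2 = τ * Q / (3 * L * w * κ * V) :=
    Real.sq_sqrt (by positivity)
  have ha : τ * Q / L =
      V * w * κ * (3 * Real.sqrt (τ * Q / (3 * L * w * κ * V)) ^ 2) := by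
    rw [hsq]
    field_simp
  have hc : 0 ≤ V * w * κ := by positivity
  have hmin := mul_le_mul_of_nonneg_left
    (cubic_min_le (Real.sqrt_nonneg (τ * Q / (3 * L * w * κ * V))) hf hfm) hc
  rw [ha]
  linarith
end

section
/- Let Q ≥ 0 and let a, W, τ, Γ, N₀, V, w, P_max be positive real numbers. Define p̂ = min{ max{ a·W·(Q·τ/(V·w·ln 2) − N₀/Γ), 0 }, P_max }. Then for every p with 0 ≤ p ≤ P_max, one has −Q·a·W·τ·logb 2 (1 + Γ·p̂/(a·N₀·W)) + V·w·p̂ ≤ −Q·a·W·τ·logb 2 (1 + Γ·p/(a·N₀·W)) + V·w·p; that is, p̂ minimizes the objective of subproblem P3-C over [0, P_max]. -/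
/-- The variational inequality of the projection of `s` onto `[0, b]`. -/
theorem sub_clamp_mul_sub_clamp_nonpos {b s p : ℝ} (hp : 0 ≤ p) (hpb : p ≤ b) :
    (s - min (max s 0) b) * (p - min (max s 0) b) ≤ 0 := by
  rcases le_total s 0 with hs | hs
  · rw [max_eq_right hs, min_eq_left (hp.trans hpb)]
    nlinarith
  · rw [max_eq_left hs]
    rcases le_total s b with hb | hb
    · simp [min_eq_left hb]
    · rw [min_eq_right hb]
      nlinarith

/-- Optimality over `[0, b]` of the clamped stationary point of
`p ↦ -C log (1 + p / d) + c p`. -/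
theorem neg_mul_log_add_mul_clamp_le {C c d b p : ℝ} (hC : 0 ≤ C) (hc : 0 < c) (hd : 0 < d)
    (hp : 0 ≤ p) (hpb : p ≤ b) :
    -C * Real.log (1 + min (max (C / c - d) 0) b / d) + c * min (max (C / c - d) 0) b ≤
      -C * Real.log (1 + p / d) + c * p := by
  have key := sub_clamp_mul_sub_clamp_nonpos (s := C / c - d) hp hpb
  have hq : 0 ≤ min (max (C / c - d) 0) b := le_min (le_max_right _ _) (hp.trans hpb)
  generalize min (max (C / c - d) 0) b = q at key hq ⊢
  have hdq : 0 < d + q := by linarith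
  have hlog : Real.log (1 + p / d) - Real.log (1 + q / d) ≤ (p - q) / (d + q) := by
    rw [← Real.log_div (by positivity) (by positivity)]
    refine (Real.log_le_sub_one_of_pos (by positivity)).trans_eq ?_
    field_simp
    ring
  have hslope : C * ((p - q) / (d + q)) ≤ c * (p - q) := by
    rw [← mul_div_assoc, div_le_iff₀ hdq]
    have h := mul_nonpos_of_nonneg_of_nonpos hc.le key
    have e : c * ((C / c - d - q) * (p - q)) = (C - c * (d + q)) * (p - q) := by
      field_simp
      ring
    linarith
  linarith [mul_le_mul_of_nonneg_left hlog hC]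

/-- Closed-form optimal transmission power (paper's equation (36)):
`p̂ = min (max (a W (Q τ / (V w ln 2) - N₀/Γ)) 0) P_max` minimizes
`h(p) = -Q a W τ log₂(1 + Γ p / (a N₀ W)) + V w p` over `[0, P_max]`. -/
theorem optimal_transmission_power (Q a W τ Γ N₀ V w Pmax : ℝ)
    (hQ : 0 ≤ Q) (ha : 0 < a) (hW : 0 < W) (hτ : 0 < τ) (hΓ : 0 < Γ)
    (hN₀ : 0 < N₀) (hV : 0 < V) (hw : 0 < w) (hPmax : 0 < Pmax) :
    ∀ p : ℝ, 0 ≤ p → p ≤ Pmax →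
      -Q * a * W * τ *
            Real.logb 2 (1 + Γ *
              (min (max (a * W * (Q * τ / (V * w * Real.log 2) - N₀ / Γ)) 0) Pmax) /
              (a * N₀ * W)) +
          V * w * (min (max (a * W * (Q * τ / (V * w * Real.log 2) - N₀ / Γ)) 0) Pmax) ≤
        -Q * a * W * τ * Real.logb 2 (1 + Γ * p / (a * N₀ * W)) + V * w * p := by
  intro p hp hpb
  have hlog2 : 0 < Real.log 2 := Real.log_pos one_lt_two
  have h := neg_mul_log_add_mul_clamp_le (C := Q * a * W * τ / Real.log 2) (c := V * w)
    (d := a * N₀ * W / Γ) (by positivity) (by positivity) (by positivity) hp hpb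
  have hs : Q * a * W * τ / Real.log 2 / (V * w) - a * N₀ * W / Γ =
      a * W * (Q * τ / (V * w * Real.log 2) - N₀ / Γ) := by
    field_simp
  rw [hs] at h
  have hobj (x : ℝ) : -Q * a * W * τ * Real.logb 2 (1 + Γ * x / (a * N₀ * W)) =
      -(Q * a * W * τ / Real.log 2) * Real.log (1 + x / (a * N₀ * W / Γ)) := by
    rw [Real.logb, div_div_eq_mul_div, mul_comm x Γ]
    ring
  rwa [hobj, hobj]
end

section
/- Let Q ≥ 0 and let W, τ, c be positive real numbers. The function a ↦ −Q·a·W·τ·logb 2 (1 + c/a) is convex on (0, ∞). -/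
/-- The perspective of `t ↦ log (1 + c * t)` is concave on the positive half-line. -/
theorem concaveOn_mul_log_one_add_div {c : ℝ} (hc : 0 ≤ c) :
    ConcaveOn ℝ (Set.Ioi (0 : ℝ)) (fun a : ℝ => a * Real.log (1 + c / a)) := by
  refine ⟨convex_Ioi 0, ?_⟩
  intro x hx y hy u v hu hv huv
  have hs : 0 < u * x + v * y := convex_Ioi (0 : ℝ) hx hy hu hv huv
  simp only [Set.mem_Ioi, smul_eq_mul] at hx hy ⊢
  have hlog := strictConcaveOn_log_Ioi.concaveOn.2
    (show 1 + c / x ∈ Set.Ioi (0 : ℝ) from Set.mem_Ioi.2 (by positivity))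
    (show 1 + c / y ∈ Set.Ioi (0 : ℝ) from Set.mem_Ioi.2 (by positivity))
    (show 0 ≤ u * x / (u * x + v * y) by positivity)
    (show 0 ≤ v * y / (u * x + v * y) by positivity)
    (by rw [← add_div, div_self hs.ne'])
  have hmean : u * x / (u * x + v * y) * (1 + c / x) + v * y / (u * x + v * y) * (1 + c / y)
      = 1 + c / (u * x + v * y) := by
    field_simp
    linear_combination c * huv
  simp only [smul_eq_mul] at hlog
  rw [hmean] at hlog
  calc u * (x * Real.log (1 + c / x)) + v * (y * Real.log (1 + c / y))
      = (u * x + v * y) * (u * x / (u * x + v * y) * Real.log (1 + c / x)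
          + v * y / (u * x + v * y) * Real.log (1 + c / y)) := by
        field_simp
    _ ≤ (u * x + v * y) * Real.log (1 + c / (u * x + v * y)) :=
        mul_le_mul_of_nonneg_left hlog hs.le

/-- Convexity of the per-node objective of subproblem P3-D:
for `Q ≥ 0` and positive `W, τ, c`, the function
`a ↦ -Q a W τ log₂(1 + c/a)` is convex on `(0, ∞)`. -/
theorem bandwidth_objective_convex (Q W τ c : ℝ)
    (hQ : 0 ≤ Q) (hW : 0 < W) (hτ : 0 < τ) (hc : 0 < c) :
    ConvexOn ℝ (Set.Ioi (0 : ℝ))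
      (fun a : ℝ => -Q * a * W * τ * Real.logb 2 (1 + c / a)) := by
  have hlog2 : 0 < Real.log 2 := Real.log_pos one_lt_two
  have hcoef : 0 ≤ Q * W * τ / Real.log 2 := by positivity
  refine ((concaveOn_mul_log_one_add_div hc.le).smul hcoef).neg.congr ?_
  intro a _
  simp only [Pi.neg_apply, smul_eq_mul, Real.logb]
  ring
end
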